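/- arXiv:1901.03429 — 11 statements merged into one kernel-verified Lean document; each statement's English description precedes it below -/
import Mathlib

section
/- Proportion invariance of Transformers without positional encodings: let Trans be any Transformer network (with arbitrary scoring function and any normalization function ρ of the normalized form), s ∈ ℚ^d a seed vector, r ∈ ℕ, and f : Σ → ℚ^d an embedding function. Then for all strings u, w ∈ Σ^* such that u ∈ PropInv(w), it holds that Trans(f(w), s, r) = Trans(f(u), s, r). -/
/-- Vectors in ℚ^d. -/
abbrev Vec (d : ℕ) := Fin d → ℚ

/-- Attention with a normalization function ρ of the normalized form
`ρᵢ(x₁,…,xₙ) = f_ρ(xᵢ)/Σⱼ f_ρ(xⱼ)`: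
`Att(q,K,V) = Σᵢ (f_ρ(score(q,kᵢ)) / Σⱼ f_ρ(score(q,kⱼ))) • vᵢ`
(keys and values given as lists of the same length). -/
def att {d : ℕ} (score : Vec d → Vec d → ℚ) (fρ : ℚ → ℚ)
    (q : Vec d) (ks vs : List (Vec d)) : Vec d :=
  ((ks.map fun k => fρ (score q k)).sum)⁻¹ •
    (List.zipWith (fun k v => fρ (score q k) • v) ks vs).sum

/-- The parameters `Q(·), K(·), V(·), O(·)` of a single encoder or decoder layer. -/
structure TLayer (d : ℕ) where
  Q : Vec d → Vec d
  K : Vec d → Vec d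
  V : Vec d → Vec d
  O : Vec d → Vec d

/-- A Transformer network: a scoring function, a normalization function of the
normalized form (given by `f_ρ` with positive values), encoder layers with the two
final transformations `K(·)`, `V(·)`, decoder layers, and the final function `F`. -/
structure Transformer (d : ℕ) where
  score : Vec d → Vec d → ℚ
  fρ : ℚ → ℚ
  fρ_pos : ∀ x : ℚ, 0 < fρ x
  encLayers : List (TLayer d)
  encK : Vec d → Vec d
  encV : Vec d → Vec d
  decLayers : List (TLayer d)
  F : Vec d → Vec d

/-- A single-layer encoder: `aᵢ = Att(Q(xᵢ), K(X), V(X)) + xᵢ`, `zᵢ = O(aᵢ) + aᵢ`. -/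
def encLayerApply {d : ℕ} (score : Vec d → Vec d → ℚ) (fρ : ℚ → ℚ) (P : TLayer d)
    (X : List (Vec d)) : List (Vec d) :=
  X.map fun x =>
    let a := att score fρ (P.Q x) (X.map P.K) (X.map P.V) + x
    P.O a + a

/-- The Transformer encoder: the composition of the single-layer encoders followed
by the final transformations `K(·)` and `V(·)`, producing `(K^e, V^e)`. -/
def Transformer.encode {d : ℕ} (T : Transformer d) (X : List (Vec d)) :
    List (Vec d) × List (Vec d) :=
  let Z := T.encLayers.foldl (fun Xc P => encLayerApply T.score T.fρ P Xc) X
  (Z.map T.encK, Z.map T.encV)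

/-- A single-layer decoder: `pᵢ = Att(Q(yᵢ), K(Yᵢ), V(Yᵢ)) + yᵢ` where
`Yᵢ = (y₁,…,yᵢ)`, `aᵢ = Att(pᵢ, K^e, V^e) + pᵢ`, `zᵢ = O(aᵢ) + aᵢ`. -/
def decLayerApply {d : ℕ} (score : Vec d → Vec d → ℚ) (fρ : ℚ → ℚ) (P : TLayer d)
    (Ke Ve : List (Vec d)) (Y : List (Vec d)) : List (Vec d) :=
  (List.range Y.length).map fun i =>
    let y := Y.getD i 0
    let Yi := Y.take (i + 1)
    let p := att score fρ (P.Q y) (Yi.map P.K) (Yi.map P.V) + y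
    let a := att score fρ p Ke Ve + p
    P.O a + a

/-- The Transformer decoder: the composition of the single-layer decoders, with the
final function `F` applied to the last vector of the decoded sequence. -/
def Transformer.decode {d : ℕ} (T : Transformer d) (KV : List (Vec d) × List (Vec d))
    (Y : List (Vec d)) : Vec d :=
  T.F ((T.decLayers.foldl (fun Yc P => decLayerApply T.score T.fρ P KV.1 KV.2 Yc)
    Y).getLastD 0)

/-- The history `(y₀, y₁, …, y_t)` of the Transformer computation:
`y_{t+1} = TDec(TEnc(X), (y₀,…,y_t))`. -/
def Transformer.hist {d : ℕ} (T : Transformer d) (X : List (Vec d)) (s : Vec d) :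
    ℕ → List (Vec d)
  | 0 => [s]
  | t + 1 => T.hist X s t ++ [T.decode (T.encode X) (T.hist X s t)]

/-- The output sequence `Trans(X, s, r) = (y₁, …, y_r)` of the Transformer. -/
def Transformer.run {d : ℕ} (T : Transformer d) (X : List (Vec d)) (s : Vec d)
    (r : ℕ) : List (Vec d) :=
  (T.hist X s r).drop 1

/-- `prop(a,w)`: the number of occurrences of `a` in `w` divided by the length of `w`. -/
def prp {α : Type*} [DecidableEq α] (a : α) (w : List α) : ℚ :=
  ((w.count a : ℚ)) / ((w.length : ℚ))

theorem List.sum_map_eq_length_smul_sum_prp {α M : Type*} [Fintype α] [DecidableEq α]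
    [AddCommGroup M] [Module ℚ M] (w : List α) (h : α → M) :
    (w.map h).sum = (w.length : ℚ) • ∑ a, prp a w • h a := by
  rcases eq_or_ne w [] with rfl | hw
  · simp
  have hlen : (w.length : ℚ) ≠ 0 := by simpa using hw
  rw [Finset.sum_list_map_count, Finset.smul_sum,
    Finset.sum_subset (Finset.subset_univ w.toFinset)
      (fun a _ ha => by simp [List.count_eq_zero_of_not_mem (by simpa using ha : a ∉ w)])]
  refine Finset.sum_congr rfl fun a _ => ?_
  rw [smul_smul, prp, mul_div_cancel₀ _ hlen, Nat.cast_smul_eq_nsmul]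

theorem eq_nil_of_prp_eq_zero {α : Type*} [DecidableEq α] {w : List α}
    (h : ∀ a, prp a w = 0) : w = [] := by
  refine List.eq_nil_iff_forall_not_mem.2 fun a ha => ?_
  have hlen : (w.length : ℚ) ≠ 0 := by simpa using List.ne_nil_of_mem ha
  have hcount : (w.count a : ℚ) ≠ 0 := by
    exact_mod_cast (List.count_pos_iff.2 ha).ne'
  exact div_ne_zero hcount hlen (h a)

theorem att_map_eq_of_prp_eq {d : ℕ} {α : Type*} [Fintype α] [DecidableEq α]
    (score : Vec d → Vec d → ℚ) (fρ : ℚ → ℚ) {u w : List α}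
    (hu : ∀ a, prp a w = prp a u) (q : Vec d) (k v : α → Vec d) :
    att score fρ q (w.map k) (w.map v) = att score fρ q (u.map k) (u.map v) := by
  rcases eq_or_ne w [] with rfl | hw
  · rw [eq_nil_of_prp_eq_zero (w := u) fun a => by rw [← hu a]; simp [prp]]
  have hu' : u ≠ [] := by
    rintro rfl
    exact hw (eq_nil_of_prp_eq_zero fun a => by rw [hu a]; simp [prp])
  have att_map : ∀ {l : List α}, l ≠ [] → att score fρ q (l.map k) (l.map v) =
      (∑ a, prp a l • fρ (score q (k a)))⁻¹ •
        ∑ a, prp a l • fρ (score q (k a)) • v a := by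
    intro l hl
    have hlen : (l.length : ℚ) ≠ 0 := by simpa using hl
    rw [att, List.map_map, List.zipWith_map, List.zipWith_self,
      List.sum_map_eq_length_smul_sum_prp, List.sum_map_eq_length_smul_sum_prp, smul_smul,
      smul_eq_mul, mul_inv_rev, inv_mul_cancel_right₀ hlen]
    rfl
  simp only [att_map hw, att_map hu', hu]

theorem exists_map_eq_foldl_encLayerApply {d : ℕ} {α : Type*} [Fintype α] [DecidableEq α]
    (score : Vec d → Vec d → ℚ) (fρ : ℚ → ℚ) {u w : List α}
    (hu : ∀ a, prp a w = prp a u) (Ps : List (TLayer d)) (f : α → Vec d) :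
    ∃ g : α → Vec d,
      Ps.foldl (fun X P => encLayerApply score fρ P X) (w.map f) = w.map g ∧
      Ps.foldl (fun X P => encLayerApply score fρ P X) (u.map f) = u.map g := by
  induction Ps generalizing f with
  | nil => exact ⟨f, rfl, rfl⟩
  | cons P Ps ih =>
    simp only [List.foldl_cons, encLayerApply, List.map_map,
      att_map_eq_of_prp_eq score fρ hu]
    exact ih _

theorem Transformer.att_encode_eq_of_prp_eq {d : ℕ} {α : Type*} [Fintype α] [DecidableEq α]
    (T : Transformer d) {u w : List α} (hu : ∀ a, prp a w = prp a u) (f : α → Vec d)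
    (q : Vec d) :
    att T.score T.fρ q (T.encode (w.map f)).1 (T.encode (w.map f)).2 =
      att T.score T.fρ q (T.encode (u.map f)).1 (T.encode (u.map f)).2 := by
  obtain ⟨g, hw, hu'⟩ := exists_map_eq_foldl_encLayerApply T.score T.fρ hu T.encLayers f
  simp only [Transformer.encode, hw, hu', List.map_map]
  exact att_map_eq_of_prp_eq T.score T.fρ hu q _ _

theorem Transformer.decode_congr {d : ℕ} (T : Transformer d)
    {KV KV' : List (Vec d) × List (Vec d)}
    (h : ∀ q, att T.score T.fρ q KV.1 KV.2 = att T.score T.fρ q KV'.1 KV'.2)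
    (Y : List (Vec d)) : T.decode KV Y = T.decode KV' Y := by
  simp only [Transformer.decode, decLayerApply, h]

theorem Transformer.hist_congr {d : ℕ} (T : Transformer d) {X X' : List (Vec d)}
    (h : ∀ q, att T.score T.fρ q (T.encode X).1 (T.encode X).2 =
      att T.score T.fρ q (T.encode X').1 (T.encode X').2) (s : Vec d) (r : ℕ) :
    T.hist X s r = T.hist X' s r := by
  induction r with
  | zero => rfl
  | succ t ih => rw [Transformer.hist, Transformer.hist, ih, T.decode_congr h]

/-- Proportion invariance of Transformers without positional encodings: for any
Transformer `Trans`, seed `s`, `r ∈ ℕ`, embedding `f : Σ → ℚ^d`, and strings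
`u, w ∈ Σ*` with `u ∈ PropInv(w)` (i.e. `prop(a,w) = prop(a,u)` for every `a ∈ Σ`),
`Trans(f(w), s, r) = Trans(f(u), s, r)`. -/
theorem transformer_prop_invariance {d : ℕ} {α : Type*} [Fintype α] [DecidableEq α]
    (T : Transformer d) (s : Vec d) (r : ℕ) (f : α → Vec d) (u w : List α)
    (hu : ∀ a : α, prp a w = prp a u) :
    T.run (w.map f) s r = T.run (u.map f) s r := by
  exact congrArg (List.drop 1) (T.hist_congr (T.att_encode_eq_of_prp_eq hu f) s r)
end

section
/- Transformers without positional encodings are order-invariant: for any Transformer network Trans, seed s ∈ ℚ^d, r ∈ ℕ, embedding f : Σ → ℚ^d, and strings u, w ∈ Σ^* such that u is a permutation of w (i.e., u is obtained by permuting the symbols of w), it holds that Trans(f(w), s, r) = Trans(f(u), s, r). -/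
theorem att_map_perm {d : ℕ} (score : Vec d → Vec d → ℚ) (fρ : ℚ → ℚ) (q : Vec d)
    (k v : Vec d → Vec d) {X Y : List (Vec d)} (h : X.Perm Y) :
    att score fρ q (X.map k) (X.map v) = att score fρ q (Y.map k) (Y.map v) := by
  simp only [att, List.map_map, List.zipWith_map, List.zipWith_self]
  rw [(h.map _).sum_eq, (h.map fun x => fρ (score q (k x)) • v x).sum_eq]

theorem encLayerApply_perm {d : ℕ} (score : Vec d → Vec d → ℚ) (fρ : ℚ → ℚ) (P : TLayer d)
    {X Y : List (Vec d)} (h : X.Perm Y) :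
    (encLayerApply score fρ P X).Perm (encLayerApply score fρ P Y) := by
  simp only [encLayerApply, att_map_perm score fρ _ P.K P.V h]
  exact h.map _

theorem foldl_encLayerApply_perm {d : ℕ} (score : Vec d → Vec d → ℚ) (fρ : ℚ → ℚ)
    (Ps : List (TLayer d)) {X Y : List (Vec d)} (h : X.Perm Y) :
    (Ps.foldl (fun Xc P => encLayerApply score fρ P Xc) X).Perm
      (Ps.foldl (fun Xc P => encLayerApply score fρ P Xc) Y) := by
  induction Ps generalizing X Y with
  | nil => exact h
  | cons P Ps ih => exact ih (encLayerApply_perm score fρ P h)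

theorem Transformer.decode_encode_perm {d : ℕ} (T : Transformer d) {X Y : List (Vec d)}
    (h : X.Perm Y) (Z : List (Vec d)) :
    T.decode (T.encode X) Z = T.decode (T.encode Y) Z := by
  simp only [Transformer.decode, Transformer.encode, decLayerApply,
    att_map_perm T.score T.fρ _ T.encK T.encV
      (foldl_encLayerApply_perm T.score T.fρ T.encLayers h)]

theorem Transformer.hist_perm {d : ℕ} (T : Transformer d) {X Y : List (Vec d)}
    (h : X.Perm Y) (s : Vec d) (t : ℕ) : T.hist X s t = T.hist Y s t := by
  induction t with
  | zero => rfl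
  | succ t ih => simp only [Transformer.hist, ih, T.decode_encode_perm h]

/-- Transformers without positional encodings are order-invariant: for any
Transformer `Trans`, seed `s`, `r ∈ ℕ`, embedding `f : Σ → ℚ^d`, and strings
`u, w ∈ Σ*` such that `u` is a permutation of `w`,
`Trans(f(w), s, r) = Trans(f(u), s, r)`. -/
theorem transformer_order_invariance {d : ℕ} {α : Type*} [Fintype α]
    (T : Transformer d) (s : Vec d) (r : ℕ) (f : α → Vec d) (u w : List α)
    (hperm : u.Perm w) :
    T.run (w.map f) s r = T.run (u.map f) s r := by
  exact congrArg (List.drop 1) (T.hist_perm (hperm.map f).symm s r)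
end

section
/- The order-invariant regular language L = { w ∈ {a,b}^* : w has an even number of occurrences of the symbol a } cannot be recognized by any Transformer network without positional encodings: there is no seq-to-seq language recognizer A = (Σ, f, Trans, s, 𝔽) whose network is a Transformer such that L(A) = L. -/
/-- A seq-to-seq language recognizer `A = (Σ, f, N, s, 𝔽)`: an embedding function
`f : Σ → ℚ^d` computable by a Turing machine (in the paper, in linear time), a
seq-to-seq network `N` mapping an input sequence, a seed and `r : ℕ` to an output
sequence `(y₁,…,y_r)`, a seed vector `s`, and a set `𝔽 ⊆ ℚ^d` of final vectors
whose membership is decidable by a Turing machine (in the paper, in linear time). -/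
structure Recognizer (α : Type) [Primcodable α] (d : ℕ) where
  emb : α → Vec d
  emb_computable : Computable emb
  net : List (Vec d) → Vec d → ℕ → List (Vec d)
  seed : Vec d
  final : Set (Vec d)
  final_computable : ComputablePred (· ∈ final)

/-- `A` accepts `w` iff there is `r ∈ ℕ` with `N(f(w), s, r) = (y₁,…,y_r)`
and `y_r ∈ 𝔽`. -/
def Recognizer.Accepts {α : Type} [Primcodable α] {d : ℕ} (A : Recognizer α d)
    (w : List α) : Prop :=
  ∃ (r : ℕ) (y : Vec d),
    (A.net (w.map A.emb) A.seed r).getLast? = some y ∧ y ∈ A.final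

/-- Attention over `n ≠ 0` copies of one key-value pair returns the value. -/
theorem att_replicate {d : ℕ} (score : Vec d → Vec d → ℚ) {fρ : ℚ → ℚ}
    (hf : ∀ x, 0 < fρ x) (q k v : Vec d) {n : ℕ} (hn : n ≠ 0) :
    att score fρ q (List.replicate n k) (List.replicate n v) = v := by
  have hne : (n : ℚ) * fρ (score q k) ≠ 0 :=
    mul_ne_zero (Nat.cast_ne_zero.mpr hn) (hf _).ne'
  have hsum : (n • fρ (score q k) • v : Vec d) = ((n : ℚ) * fρ (score q k)) • v := by
    rw [← Nat.cast_smul_eq_nsmul ℚ, smul_smul]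
  simp only [att, List.map_replicate, List.zipWith_replicate, min_self, List.sum_replicate]
  rw [hsum, nsmul_eq_mul, smul_smul, inv_mul_cancel₀ hne, one_smul]

theorem encLayerApply_replicate {d : ℕ} (score : Vec d → Vec d → ℚ) {fρ : ℚ → ℚ}
    (hf : ∀ x, 0 < fρ x) (P : TLayer d) (x : Vec d) {n : ℕ} (hn : n ≠ 0) :
    encLayerApply score fρ P (List.replicate n x) =
      List.replicate n (P.O (P.V x + x) + (P.V x + x)) := by
  simp only [encLayerApply, List.map_replicate, att_replicate score hf _ _ _ hn]

theorem exists_foldl_encLayerApply_replicate {d : ℕ} (score : Vec d → Vec d → ℚ)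
    {fρ : ℚ → ℚ} (hf : ∀ x, 0 < fρ x) (layers : List (TLayer d)) (x : Vec d) :
    ∃ z : Vec d, ∀ n : ℕ, n ≠ 0 →
      layers.foldl (fun Xc P => encLayerApply score fρ P Xc) (List.replicate n x) =
        List.replicate n z := by
  induction layers generalizing x with
  | nil => exact ⟨x, fun n _ => rfl⟩
  | cons P layers ih =>
    obtain ⟨z, hz⟩ := ih (P.O (P.V x + x) + (P.V x + x))
    refine ⟨z, fun n hn => ?_⟩
    rw [List.foldl_cons, encLayerApply_replicate score hf P x hn, hz n hn]

theorem Transformer.exists_encode_replicate {d : ℕ} (T : Transformer d) (x : Vec d) :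
    ∃ k v : Vec d, ∀ n : ℕ, n ≠ 0 →
      T.encode (List.replicate n x) = (List.replicate n k, List.replicate n v) := by
  obtain ⟨z, hz⟩ := exists_foldl_encLayerApply_replicate T.score T.fρ_pos T.encLayers x
  refine ⟨T.encK z, T.encV z, fun n hn => ?_⟩
  simp only [Transformer.encode, hz n hn, List.map_replicate]

theorem Transformer.decode_replicate {d : ℕ} (T : Transformer d) (k v : Vec d) {m n : ℕ}
    (hm : m ≠ 0) (hn : n ≠ 0) (Y : List (Vec d)) :
    T.decode (List.replicate m k, List.replicate m v) Y =
      T.decode (List.replicate n k, List.replicate n v) Y := by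
  simp only [Transformer.decode, decLayerApply, att_replicate T.score T.fρ_pos _ _ _ hm,
    att_replicate T.score T.fρ_pos _ _ _ hn]

/-- A Transformer cannot count the copies of a repeated input vector. -/
theorem Transformer.run_replicate {d : ℕ} (T : Transformer d) (x s : Vec d) {m n : ℕ}
    (hm : m ≠ 0) (hn : n ≠ 0) (r : ℕ) :
    T.run (List.replicate m x) s r = T.run (List.replicate n x) s r := by
  obtain ⟨k, v, h⟩ := T.exists_encode_replicate x
  have hist_eq : T.hist (List.replicate m x) s r = T.hist (List.replicate n x) s r := by
    induction r with
    | zero => rfl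
    | succ t ih =>
      simp only [Transformer.hist]
      rw [ih, h m hm, h n hn, T.decode_replicate k v hm hn]
  rw [Transformer.run, Transformer.run, hist_eq]

/-- The order-invariant regular language
`L = { w ∈ {a,b}* : w has an even number of a's }` cannot be recognized by any
Transformer network without positional encodings.  Here the two-symbol alphabet
`{a,b}` is modeled as `Bool`, with `true` playing the role of `a`. -/
theorem no_transformer_recognizes_even_a :
    ¬ ∃ (d : ℕ) (T : Transformer d) (A : Recognizer Bool d),
        A.net = T.run ∧ ∀ w : List Bool, A.Accepts w ↔ Even (w.count true) := by
  rintro ⟨d, T, A, hnet, hA⟩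
  have hiff : A.Accepts (List.replicate 1 true) ↔ A.Accepts (List.replicate 2 true) := by
    simp only [Recognizer.Accepts, hnet, List.map_replicate,
      T.run_replicate (A.emb true) A.seed one_ne_zero two_ne_zero]
  rw [hA, hA, List.count_replicate_self, List.count_replicate_self] at hiff
  exact Nat.not_even_one (hiff.mpr even_two)
end

section
/- There is a Transformer network (without positional encodings, of dimension d = 2, with one encoder layer and one decoder layer) and a seq-to-seq language recognizer A using it that recognizes the non-regular language S = { w ∈ {a,b}^* : w has strictly more occurrences of a than of b }, i.e., L(A) = S. -/
/-- Attention with constant weights averages the values. -/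
theorem att_uniform {d : ℕ} (q : Vec d) (ks : List (Vec d)) :
    att (fun _ _ => 0) (fun _ => 1) q ks ks = ((ks.length : ℚ))⁻¹ • ks.sum := by
  simp [att]

theorem att_replicate_zero {d : ℕ} (score : Vec d → Vec d → ℚ) (fρ : ℚ → ℚ)
    (q : Vec d) (ks : List (Vec d)) (n : ℕ) :
    att score fρ q ks (List.replicate n 0) = 0 := by
  have h : (List.zipWith (fun k v => fρ (score q k) • v) ks
      (List.replicate n (0 : Vec d))).sum = 0 := by
    apply List.sum_eq_zero
    intro x hx
    rw [← List.map_uncurry_zip_eq_zipWith, List.mem_map] at hx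
    obtain ⟨⟨k, v⟩, hkv, rfl⟩ := hx
    simp [List.eq_of_mem_replicate (List.of_mem_zip hkv).2]
  rw [att, h, smul_zero]

/-- The layer whose self-attention and feed-forward parts vanish. -/
def trivialLayer : TLayer 2 where
  Q := fun x => x
  K := fun x => x
  V := fun _ => 0
  O := fun _ => 0

/-- The letter `a` (`true`) is sent to `(1, 0)` and `b` (`false`) to `(-1, 0)`. -/
def majorityEmb : Bool → Vec 2
  | true => ![1, 0]
  | false => ![-1, 0]

/-- The Transformer that averages its inputs and outputs `(0, 1)` if the first coordinate of
the average is positive, and `(0, 0)` otherwise. -/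
def majorityTransformer : Transformer 2 where
  score := fun _ _ => 0
  fρ := fun _ => 1
  fρ_pos := fun _ => one_pos
  encLayers := [trivialLayer]
  encK := fun x => x
  encV := fun x => x
  decLayers := [trivialLayer]
  F := fun x => if 0 < x 0 then ![0, 1] else 0

theorem majorityTransformer_encode (X : List (Vec 2)) :
    majorityTransformer.encode X = (X, X) := by
  simp [Transformer.encode, majorityTransformer, encLayerApply, trivialLayer, att_replicate_zero]

theorem majorityTransformer_decode (X Y : List (Vec 2)) (hne : Y ≠ [])
    (hY : ∀ y ∈ Y, y 0 = 0) :
    majorityTransformer.decode (X, X) Y =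
      if 0 < ((X.length : ℚ))⁻¹ * X.sum 0 then ![0, 1] else 0 := by
  obtain ⟨L, y, rfl⟩ := List.eq_nil_or_concat' Y |>.resolve_left hne
  have hy : y 0 = 0 := hY y (by simp)
  simp [Transformer.decode, majorityTransformer, decLayerApply, trivialLayer, att_uniform,
    List.range_succ, hy, ← List.replicate_succ', att_replicate_zero]

theorem majorityTransformer_hist (X : List (Vec 2)) (r : ℕ) :
    majorityTransformer.hist X 0 r = 0 :: List.replicate r
      (if 0 < ((X.length : ℚ))⁻¹ * X.sum 0 then ![0, 1] else 0) := by
  induction r with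
  | zero => rfl
  | succ r ih =>
    rw [Transformer.hist, ih, majorityTransformer_encode, majorityTransformer_decode]
    · rw [List.replicate_succ', List.cons_append]
    · simp
    · intro y hy
      rcases List.mem_cons.1 hy with rfl | hy
      · rfl
      · rw [List.eq_of_mem_replicate hy]
        split_ifs <;> rfl

theorem sum_map_majorityEmb (w : List Bool) :
    (w.map majorityEmb).sum 0 = (w.count true : ℚ) - w.count false := by
  induction w with
  | nil => simp
  | cons c w ih =>
    cases c <;> simp [ih, majorityEmb] <;> ring

theorem average_majorityEmb_pos_iff (w : List Bool) :
    0 < (((w.map majorityEmb).length : ℚ))⁻¹ * (w.map majorityEmb).sum 0 ↔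
      w.count false < w.count true := by
  rw [sum_map_majorityEmb, List.length_map]
  rcases w.eq_nil_or_concat with rfl | ⟨L, c, rfl⟩
  · simp
  · rw [mul_pos_iff_of_pos_left (by simp; positivity), sub_pos, Nat.cast_lt]

/-- The recognizer with seed `(0, 0)` and single final vector `(0, 1)`. -/
def majorityRecognizer : Recognizer Bool 2 where
  emb := majorityEmb
  emb_computable := (Primrec.dom_finite _).to_comp
  net := majorityTransformer.run
  seed := 0
  final := {![0, 1]}
  final_computable :=
    ⟨inferInstanceAs (DecidablePred fun x : Vec 2 => x = ![0, 1]),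
      (Primrec.eq.comp Primrec.id (Primrec.const _)).decide.to_comp⟩

theorem majorityRecognizer_accepts (w : List Bool) :
    majorityRecognizer.Accepts w ↔ w.count false < w.count true := by
  rw [← average_majorityEmb_pos_iff]
  simp only [Recognizer.Accepts, majorityRecognizer, Transformer.run, majorityTransformer_hist,
    List.drop_succ_cons, List.drop_zero, Set.mem_singleton_iff]
  constructor
  · rintro ⟨r, y, hy, rfl⟩
    have h := List.eq_of_mem_replicate (List.mem_of_getLast? hy)
    by_contra hn
    rw [if_neg hn] at h
    simpa using congrFun h 1
  · intro h
    exact ⟨1, _, rfl, if_pos h⟩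

/-- There is a Transformer network without positional encodings, of dimension
`d = 2`, with one encoder layer and one decoder layer, and a seq-to-seq language
recognizer `A` using it, recognizing the non-regular language
`S = { w ∈ {a,b}* : w has strictly more a's than b's }`.  Here the two-symbol
alphabet `{a,b}` is modeled as `Bool`, with `true` playing the role of `a`. -/
theorem transformer_recognizes_strict_majority :
    ∃ (T : Transformer 2) (A : Recognizer Bool 2),
      T.encLayers.length = 1 ∧ T.decLayers.length = 1 ∧ A.net = T.run ∧
      ∀ w : List Bool, A.Accepts w ↔ w.count false < w.count true := by
  exact ⟨majorityTransformer, majorityRecognizer, rfl, rfl, rfl, majorityRecognizer_accepts⟩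
end

section
/- A uniform Neural GPU with circular convolutions preserves vertical periodicity: let p ≥ 1 divide h and let S^{t−1} ∈ ℚ^{h×w×d} satisfy S^{t−1}_{i,:,:} = S^{t−1}_{i+p,:,:} for all i (first index modulo h). Then the next tensor S^t = U^t ⊙ S^{t−1} + (1 − U^t) ⊙ f_F(K^F ⊛ (R^t ⊙ S^{t−1}) + B^F), with U^t = f_U(K^U ⊛ S^{t−1} + B^U) and R^t = f_R(K^R ⊛ S^{t−1} + B^R), also satisfies S^t_{i,:,:} = S^t_{i+p,:,:} for all i. Consequently, by induction, if the input tensor S^0 is p-periodic then S^t is p-periodic for every t ≥ 0. -/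
/-- Tensors in ℚ^{h×w×d}. -/
abbrev Tensor (h w d : ℕ) := Fin h → Fin w → Vec d

/-- A kernel bank of shape (k_H, k_W, d, d). -/
abbrev KernelBank (kH kW d : ℕ) := Fin kH → Fin kW → Matrix (Fin d) (Fin d) ℚ

/-- Access to a tensor with the first index taken circularly (modulo `h`) and
zero padding in the second index. -/
def circGet {h w d : ℕ} (S : Tensor h w d) (hh : 0 < h) (i j : ℤ) : Vec d :=
  if hj : 0 ≤ j ∧ j < (w : ℤ) then
    S ⟨(i % (h : ℤ)).toNat, by
        have h1 : 0 ≤ i % (h : ℤ) := Int.emod_nonneg i (by exact_mod_cast hh.ne')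
        have h2 : i % (h : ℤ) < (h : ℤ) := Int.emod_lt_of_pos i (by exact_mod_cast hh)
        omega⟩
      ⟨j.toNat, by omega⟩
  else 0

/-- Circular convolution `K ⊛ S`. -/
def cconv {h w d kH kW : ℕ} (K : KernelBank kH kW d) (S : Tensor h w d) : Tensor h w d :=
  fun i j => ∑ u : Fin kH, ∑ v : Fin kW,
    Matrix.vecMul
      (circGet S i.pos ((i : ℤ) + (u : ℤ) - ((kH / 2 : ℕ) : ℤ))
        ((j : ℤ) + (v : ℤ) - ((kW / 2 : ℕ) : ℤ)))
      (K u v)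

/-- A uniform Neural GPU (with circular convolutions): kernel banks `K^U, K^R, K^F`
of shape (k_H,k_W,d,d), uniform bias tensors given by matrices `B^U, B^R, B^F ∈ ℚ^{w×d}`
(the bias tensor has `B_{i,:,:} = B'` for every `i`), and pointwise activation
functions `f_U, f_R, f_F`.  Being height-generic, it acts on tensors of any height. -/
structure UCNGPU (w d : ℕ) where
  kH : ℕ
  kW : ℕ
  KU : KernelBank kH kW d
  KR : KernelBank kH kW d
  KF : KernelBank kH kW d
  BU : Fin w → Vec d
  BR : Fin w → Vec d
  BF : Fin w → Vec d
  fU : ℚ → ℚ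
  fR : ℚ → ℚ
  fF : ℚ → ℚ

/-- One step of the Neural GPU with circular convolutions:
`S^t = U^t ⊙ S^{t−1} + (1 − U^t) ⊙ f_F(K^F ⊛ (R^t ⊙ S^{t−1}) + B^F)`,
where `U^t = f_U(K^U ⊛ S^{t−1} + B^U)` and `R^t = f_R(K^R ⊛ S^{t−1} + B^R)`. -/
def UCNGPU.step {w d : ℕ} (N : UCNGPU w d) {h : ℕ} (S : Tensor h w d) : Tensor h w d :=
  let Ut : Tensor h w d := fun i j => fun k => N.fU ((cconv N.KU S i j + N.BU j) k)
  let Rt : Tensor h w d := fun i j => fun k => N.fR ((cconv N.KR S i j + N.BR j) k)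
  fun i j => fun k =>
    Ut i j k * S i j k +
      (1 - Ut i j k) *
        N.fF ((cconv N.KF (fun a b => fun c => Rt a b c * S a b c) i j + N.BF j) k)

/-- Periodicity of a tensor along its first index, taken circularly. -/
def Tensor.IsPeriodic {h w d : ℕ} (p : ℕ) (S : Tensor h w d) : Prop :=
  ∀ i : Fin h, S ⟨(i + p) % h, Nat.mod_lt _ i.pos⟩ = S i

theorem circGet_add_of_isPeriodic {h w d p : ℕ} {S : Tensor h w d} (hS : S.IsPeriodic p)
    (hh : 0 < h) (i j : ℤ) : circGet S hh (i + p) j = circGet S hh i j := by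
  unfold circGet
  split_ifs with hj
  · have hi0 : 0 ≤ i % (h : ℤ) := Int.emod_nonneg i (by exact_mod_cast hh.ne')
    have hi1 : i % (h : ℤ) < h := Int.emod_lt_of_pos i (by exact_mod_cast hh)
    rw [← hS ⟨(i % (h : ℤ)).toNat, by omega⟩]
    congr 2
    zify
    rw [Int.toNat_of_nonneg hi0,
      Int.toNat_of_nonneg (Int.emod_nonneg _ (by exact_mod_cast hh.ne')), Int.emod_add_emod]
  · rfl

theorem circGet_congr_emod {h w d : ℕ} (S : Tensor h w d) (hh : 0 < h) {i i' : ℤ}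
    (hi : i % (h : ℤ) = i' % (h : ℤ)) (j : ℤ) : circGet S hh i j = circGet S hh i' j := by
  simp only [circGet, hi]

theorem Tensor.IsPeriodic.cconv {h w d kH kW p : ℕ} {S : Tensor h w d} (hS : S.IsPeriodic p)
    (K : KernelBank kH kW d) : (cconv K S).IsPeriodic p := by
  intro i
  funext j
  refine Finset.sum_congr rfl fun u _ => Finset.sum_congr rfl fun v _ => ?_
  congr 1
  refine (circGet_congr_emod S _ ?_ _).trans (circGet_add_of_isPeriodic hS _ _ _)
  push_cast
  rw [add_sub_assoc, Int.emod_add_emod]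
  congr 1
  ring

theorem Tensor.IsPeriodic.step {h w d p : ℕ} {S : Tensor h w d} (hS : S.IsPeriodic p)
    (N : UCNGPU w d) : (N.step S).IsPeriodic p := by
  have hU := hS.cconv N.KU
  have hR := hS.cconv N.KR
  have hF : Tensor.IsPeriodic p (_root_.cconv N.KF fun a b c =>
      N.fR ((_root_.cconv N.KR S a b + N.BR b) c) * S a b c) :=
    Tensor.IsPeriodic.cconv (fun i => by simp only [hR i, hS i]) N.KF
  intro i
  simp only [UCNGPU.step, hU i, hF i, hS i]

/-- A uniform Neural GPU with circular convolutions preserves vertical periodicity: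
if `p ≥ 1` divides `h` and `S_{i,:,:} = S_{i+p,:,:}` for all `i` (first index modulo `h`),
then the next tensor `S^t = step S` is also `p`-periodic; consequently, by induction,
every iterate `S^t` is `p`-periodic. -/
theorem ucngpu_step_preserves_periodicity {w d : ℕ} (N : UCNGPU w d) {h : ℕ}
    (p : ℕ) (hp : 1 ≤ p) (hdvd : p ∣ h) (S : Tensor h w d)
    (hS : ∀ i : Fin h, S ⟨(i + p) % h, Nat.mod_lt _ i.pos⟩ = S i) :
    (∀ i : Fin h, N.step S ⟨(i + p) % h, Nat.mod_lt _ i.pos⟩ = N.step S i) ∧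
    (∀ t : ℕ, ∀ i : Fin h,
      (N.step (h := h))^[t] S ⟨(i + p) % h, Nat.mod_lt _ i.pos⟩ =
        (N.step (h := h))^[t] S i) := by
  have periodic_iterate : ∀ t : ℕ, Tensor.IsPeriodic p ((N.step (h := h))^[t] S) := by
    intro t
    induction t with
    | zero => exact hS
    | succ t ih =>
      rw [Function.iterate_succ_apply']
      exact ih.step N
  exact ⟨Tensor.IsPeriodic.step hS N, periodic_iterate⟩
end

section
/- Prefix agreement for periodic inputs of a uniform Neural GPU with circular convolutions: let N be a uniform Neural GPU with circular convolutions, let p ≥ 1, and let S ∈ ℚ^{kp×w×d} and T ∈ ℚ^{k'p×w×d} be tensors that are p-periodic in their first index (S_{i,:,:} = S_{i+p,:,:} and T_{i,:,:} = T_{i+p,:,:} for all i, indices modulo the respective heights) and agree on their first p rows (S_{1:p,:,:} = T_{1:p,:,:}). Let S^1, S^2, … and T^1, T^2, … be the sequences of tensors produced by N on S and T respectively. Then for every t ≥ 0, S^t_{1:p,:,:} = T^t_{1:p,:,:}. -/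
/-- The `p`-periodic tensor of height `h` built from a tensor of height `p`. -/
def Tensor.periodize {p w d : ℕ} (hp : 0 < p) (h : ℕ) (P : Tensor p w d) : Tensor h w d :=
  fun i => P ⟨i % p, Nat.mod_lt _ hp⟩

theorem circGet_periodize {p w d h : ℕ} (hp : 0 < p) (hdvd : p ∣ h) (P : Tensor p w d)
    (hh : 0 < h) {a b : ℤ} (hab : a % p = b % p) (j : ℤ) :
    circGet (P.periodize hp h) hh a j = circGet P hp b j := by
  unfold circGet Tensor.periodize
  split_ifs with hj
  · have hmod : (a % (h : ℤ)).toNat % p = (b % (p : ℤ)).toNat := by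
      have h0 : 0 ≤ a % (h : ℤ) := Int.emod_nonneg a (by exact_mod_cast hh.ne')
      have h1 : 0 ≤ b % (p : ℤ) := Int.emod_nonneg b (by exact_mod_cast hp.ne')
      zify
      rw [Int.toNat_of_nonneg h0, Int.toNat_of_nonneg h1,
        Int.emod_emod_of_dvd a (by exact_mod_cast hdvd), hab]
    simp only [hmod]
  · rfl

theorem cconv_periodize {p w d h kH kW : ℕ} (hp : 0 < p) (hdvd : p ∣ h)
    (K : KernelBank kH kW d) (P : Tensor p w d) :
    cconv K (P.periodize hp h) = (cconv K P).periodize hp h := by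
  funext i j
  unfold cconv
  conv_rhs => unfold Tensor.periodize
  refine Finset.sum_congr rfl fun u _ => Finset.sum_congr rfl fun v _ => ?_
  rw [circGet_periodize hp hdvd P i.pos]
  push_cast
  rw [add_sub_assoc, add_sub_assoc, Int.emod_add_emod]

theorem UCNGPU.step_periodize {p w d h : ℕ} (N : UCNGPU w d) (hp : 0 < p) (hdvd : p ∣ h)
    (P : Tensor p w d) : N.step (P.periodize hp h) = (N.step P).periodize hp h := by
  unfold UCNGPU.step
  simp only [cconv_periodize hp hdvd]
  funext i j c
  exact congrArg
    (fun x : Tensor h w d => N.fU (((cconv N.KU P).periodize hp h i j + N.BU j) c) *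
      P.periodize hp h i j c + (1 - N.fU (((cconv N.KU P).periodize hp h i j + N.BU j) c)) *
        N.fF ((x i j + N.BF j) c))
    (cconv_periodize hp hdvd N.KF
      (fun a b e => N.fR ((cconv N.KR P a b + N.BR b) e) * P a b e))

theorem UCNGPU.iterate_step_periodize {p w d h : ℕ} (N : UCNGPU w d) (hp : 0 < p)
    (hdvd : p ∣ h) (P : Tensor p w d) (t : ℕ) :
    N.step^[t] (P.periodize hp h) = (N.step^[t] P).periodize hp h :=
  ((Function.Semiconj.iterate_right
    (f := Tensor.periodize hp h) (fun P => (N.step_periodize hp hdvd P).symm) t) P).symm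

theorem Tensor.eq_periodize {p w d h : ℕ} (hp : 0 < p) (hph : p ≤ h) (S : Tensor h w d)
    (hS : ∀ i : Fin h, S ⟨(i + p) % h, Nat.mod_lt _ i.pos⟩ = S i) :
    S = Tensor.periodize hp h (fun i : Fin p => S ⟨i, i.isLt.trans_le hph⟩) := by
  funext ⟨i, hi⟩
  unfold Tensor.periodize
  induction i using Nat.strong_induction_on with
  | _ i ih =>
    rcases lt_or_ge i p with hip | hip
    · simp only [Nat.mod_eq_of_lt hip]
    · have hlt : i - p < h := by omega
      have hper := hS ⟨i - p, hlt⟩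
      simp only [Nat.sub_add_cancel hip, Nat.mod_eq_of_lt hi] at hper
      have hrec := ih (i - p) (by omega) hlt
      simp only [← Nat.mod_eq_sub_mod hip] at hrec
      exact hper.trans hrec

/-- Prefix agreement for periodic inputs of a uniform Neural GPU with circular
convolutions: if `S ∈ ℚ^{kp×w×d}` and `T ∈ ℚ^{k'p×w×d}` are `p`-periodic in their
first index and agree on their first `p` rows, then for every `t ≥ 0` the produced
tensors `S^t` and `T^t` agree on their first `p` rows. -/
theorem ucngpu_prefix_agreement {w d : ℕ} (N : UCNGPU w d) (p k k' : ℕ)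
    (hp : 0 < p) (hk : 0 < k) (hk' : 0 < k')
    (S : Tensor (k * p) w d) (T : Tensor (k' * p) w d)
    (hS : ∀ i : Fin (k * p), S ⟨(i + p) % (k * p), Nat.mod_lt _ i.pos⟩ = S i)
    (hT : ∀ i : Fin (k' * p), T ⟨(i + p) % (k' * p), Nat.mod_lt _ i.pos⟩ = T i)
    (hagree : ∀ i : Fin p,
      S ⟨i, lt_of_lt_of_le i.isLt (Nat.le_mul_of_pos_left p hk)⟩ =
      T ⟨i, lt_of_lt_of_le i.isLt (Nat.le_mul_of_pos_left p hk')⟩) :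
    ∀ t : ℕ, ∀ i : Fin p,
      (N.step (h := k * p))^[t] S ⟨i, lt_of_lt_of_le i.isLt (Nat.le_mul_of_pos_left p hk)⟩ =
      (N.step (h := k' * p))^[t] T ⟨i, lt_of_lt_of_le i.isLt (Nat.le_mul_of_pos_left p hk')⟩ := by
  intro t i
  have hle := Nat.le_mul_of_pos_left p hk
  have hle' := Nat.le_mul_of_pos_left p hk'
  rw [Tensor.eq_periodize hp hle S hS, Tensor.eq_periodize hp hle' T hT, funext hagree,
    N.iterate_step_periodize hp (Dvd.intro_left k rfl),
    N.iterate_step_periodize hp (Dvd.intro_left k' rfl)]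
  rfl
end

section
/- Encoder attention lemma: let n ≥ 1, let the encoder keys be k_i = [0,…,0, i, −1, 0, 0] ∈ ℚ^d and the encoder values be v_i ∈ ℚ^d for 1 ≤ i ≤ n, and let q ∈ ℚ^d be any vector whose last four coordinates are (1, j, x, y) for some j ∈ ℕ with j ≥ 1 and arbitrary x, y, with all coordinates of q multiplying the zero coordinates of the k_i arbitrary. Then hard attention with scoring function score_φ(q,k) = −|⟨q,k⟩| satisfies Att(q, (k_1,…,k_n), (v_1,…,v_n)) = v_{β(j)}, where β(j) = j if j ≤ n and β(j) = n if j > n. -/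
/-- Hard attention: the average of the values `vⱼ` over the indices `j`
maximizing `score(q, kⱼ)`. -/
def hardAtt {d n : ℕ} (score : Vec d → Vec d → ℚ) (q : Vec d) (K V : Fin n → Vec d) :
    Vec d :=
  let S := Finset.univ.filter fun i : Fin n => ∀ j, score q (K j) ≤ score q (K i)
  ((S.card : ℚ))⁻¹ • ∑ i ∈ S, V i

/-- The scoring function `score_φ(q,k) = −|⟨q,k⟩|`. -/
def scorePhi {d : ℕ} (q k : Vec d) : ℚ := -|∑ i, q i * k i|

/-- The encoder keys `k_i = [0,…,0, i, −1, 0, 0] ∈ ℚ^{d+4}` for `1 ≤ i ≤ n`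
(`i` ranging over the 1-based positions, i.e. `(i : Fin n)` encodes position `i+1`). -/
def encKey (d : ℕ) {n : ℕ} (i : Fin n) : Vec (d + 4) :=
  fun l => if (l : ℕ) = d then ((i : ℕ) + 1 : ℚ) else if (l : ℕ) = d + 1 then -1 else 0

theorem hardAtt_eq_of_forall_lt {d n : ℕ} (score : Vec d → Vec d → ℚ) (q : Vec d)
    (K V : Fin n → Vec d) (m : Fin n) (hm : ∀ i, i ≠ m → score q (K i) < score q (K m)) :
    hardAtt score q K V = V m := by
  have hS : (Finset.univ.filter fun i : Fin n => ∀ j, score q (K j) ≤ score q (K i)) = {m} := by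
    ext i
    simp only [Finset.mem_filter, Finset.mem_univ, true_and, Finset.mem_singleton]
    constructor
    · intro h
      by_contra hi
      exact absurd (h m) (not_le.mpr (hm i hi))
    · rintro rfl k
      by_cases hk : k = i
      · rw [hk]
      · exact (hm k hk).le
  simp [hardAtt, hS]

theorem sum_mul_encKey {d n : ℕ} (q : Vec (d + 4)) (i : Fin n) :
    ∑ l, q l * encKey d i l =
      q ⟨d, by omega⟩ * ((i : ℕ) + 1 : ℚ) - q ⟨d + 1, by omega⟩ := by
  rw [Finset.sum_eq_add (⟨d, by omega⟩ : Fin (d + 4)) ⟨d + 1, by omega⟩ (by simp)]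
  · simp [encKey, sub_eq_add_neg]
  · rintro l - ⟨h₁, h₂⟩
    have h₁' : (l : ℕ) ≠ d := fun h => h₁ (Fin.ext h)
    have h₂' : (l : ℕ) ≠ d + 1 := fun h => h₂ (Fin.ext h)
    simp [encKey, h₁', h₂']
  · simp
  · simp

/-- Encoder attention lemma: for `n ≥ 1`, encoder keys `k_i = [0,…,0, i, −1, 0, 0]`,
arbitrary values `v_i`, and any query `q` whose last four coordinates are
`(1, j, x, y)` for some `j ≥ 1` (all other coordinates of `q` arbitrary, since they
multiply zero coordinates of the keys), hard attention with scoring function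
`score_φ(q,k) = −|⟨q,k⟩|` satisfies `Att(q, K, V) = v_{β(j)}`, where `β(j) = j` if
`j ≤ n` and `β(j) = n` if `j > n`. -/
theorem encoder_attention {d n : ℕ} (hn : 1 ≤ n) (vs : Fin n → Vec (d + 4))
    (q : Vec (d + 4)) (j : ℕ) (hj : 1 ≤ j)
    (hq1 : q ⟨d, by omega⟩ = 1) (hq2 : q ⟨d + 1, by omega⟩ = (j : ℚ)) :
    hardAtt scorePhi q (encKey d) vs =
      vs (if h : j ≤ n then ⟨j - 1, by omega⟩ else ⟨n - 1, by omega⟩) := by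
  apply hardAtt_eq_of_forall_lt
  intro i hi
  simp only [scorePhi, sum_mul_encKey, hq1, hq2, one_mul, neg_lt_neg_iff]
  have hlt := i.isLt
  by_cases h : j ≤ n
  · simp only [dif_pos h, ne_eq, Fin.ext_iff] at hi ⊢
    have key : |((j - 1 : ℕ) : ℤ) + 1 - j| < |((i : ℕ) : ℤ) + 1 - j| := by
      rw [show ((j - 1 : ℕ) : ℤ) + 1 - j = 0 by omega, abs_zero, abs_pos]
      omega
    exact_mod_cast key
  · simp only [dif_neg h, ne_eq, Fin.ext_iff] at hi ⊢
    have key : |((n - 1 : ℕ) : ℤ) + 1 - j| < |((i : ℕ) : ℤ) + 1 - j| := by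
      rw [abs_of_nonpos (by omega), abs_of_nonpos (by omega)]
      omega
    exact_mod_cast key
end

section
/- Head-position computation by self attention (Lemma B.3): let M be a Turing machine with head-movement values m^{(j)} ∈ {−1, 1} for j ≥ 0 and m^{(−1)} = 0, and let c^{(i)} = m^{(0)} + m^{(1)} + ⋯ + m^{(i−1)} (with c^{(0)} = 0) be the head position at time i. Let z^1_0, …, z^1_i ∈ ℚ^d be vectors (d = 2|Q| + 4|Σ| + 11) whose second block contains, at fixed coordinate positions, the values m^{(j)} and m^{(j−1)} for z^1_j. Then there exist functions Q_2, K_2, V_2 : ℚ^d → ℚ^d defined by feed-forward networks (in fact, K_2 and Q_2 constantly zero and V_2 linear) such that the hard attention with scoring function score_φ(q,k) = −|⟨q,k⟩| satisfies Att(Q_2(z^1_i), K_2(Z^1_i), V_2(Z^1_i)) = the vector that is zero everywhere except for two fixed coordinates holding c^{(i+1)}/(i+1) and c^{(i)}/(i+1), where Z^1_i = (z^1_0, …, z^1_i). -/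
/-- With the zero query all scores tie, so hard attention averages all the values. -/
theorem hardAtt_scorePhi_zero {d n : ℕ} (K V : Fin n → Vec d) :
    hardAtt scorePhi 0 K V = (n : ℚ)⁻¹ • ∑ j, V j := by
  simp [hardAtt, scorePhi]

/-- The linear map copying coordinate `a` to `a'` and coordinate `b` to `b'`, and
zeroing all other coordinates. -/
def copyCoords {d : ℕ} (a b a' b' : Fin d) (v : Vec d) : Vec d :=
  fun k => if k = a' then v a else if k = b' then v b else 0

theorem isLinearMap_copyCoords {d : ℕ} (a b a' b' : Fin d) :
    IsLinearMap ℚ (copyCoords a b a' b') where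
  map_add v w := by
    ext k
    simp only [copyCoords, Pi.add_apply]
    split_ifs <;> simp
  map_smul c v := by
    ext k
    simp only [copyCoords, Pi.smul_apply]
    split_ifs <;> simp

/-- The running sum of the values delayed by one step. -/
theorem sum_range_succ_delayed (m : ℕ → ℚ) (i : ℕ) :
    ∑ j ∈ Finset.range (i + 1), (if j = 0 then 0 else m (j - 1)) =
      ∑ j ∈ Finset.range i, m j := by
  simp [Finset.sum_range_succ']

/-- Head-position computation by self attention (Lemma B.3): given head movements
`m⁽ʲ⁾ ∈ {−1,1}` (with `m⁽⁻¹⁾ = 0`) and the head position `c⁽ⁱ⁾ = m⁽⁰⁾ + ⋯ + m⁽ⁱ⁻¹⁾`,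
and vectors `z¹₀, …, z¹ᵢ ∈ ℚ^d` (`d = 2|Q|+4|Σ|+11`) holding `m⁽ʲ⁾` and `m⁽ʲ⁻¹⁾` at
fixed coordinates `a` and `b`, there are functions `Q₂, K₂, V₂` given by feed-forward
networks (`Q₂`, `K₂` constantly zero and `V₂` linear) such that hard attention with
`score_φ` yields the vector which is zero except for two fixed coordinates `a'`, `b'`
holding `c⁽ⁱ⁺¹⁾/(i+1)` and `c⁽ⁱ⁾/(i+1)`. -/
theorem head_position_attention (nQ nS : ℕ)
    (a b a' b' : Fin (2 * nQ + 4 * nS + 11)) (hab : a' ≠ b')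
    (m : ℕ → ℚ) (hm : ∀ j, m j = -1 ∨ m j = 1) (i : ℕ)
    (z : ℕ → Vec (2 * nQ + 4 * nS + 11))
    (hz : ∀ j, j ≤ i → z j a = m j ∧ z j b = if j = 0 then 0 else m (j - 1)) :
    ∃ Q2 K2 V2 : Vec (2 * nQ + 4 * nS + 11) → Vec (2 * nQ + 4 * nS + 11),
      (∀ v, Q2 v = 0) ∧ (∀ v, K2 v = 0) ∧ IsLinearMap ℚ V2 ∧
      hardAtt scorePhi (Q2 (z i))
          (fun j : Fin (i + 1) => K2 (z j)) (fun j : Fin (i + 1) => V2 (z j)) =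
        fun k =>
          if k = a' then (∑ j ∈ Finset.range (i + 1), m j) / ((i : ℚ) + 1)
          else if k = b' then (∑ j ∈ Finset.range i, m j) / ((i : ℚ) + 1)
          else 0 := by
  refine ⟨fun _ => 0, fun _ => 0, copyCoords a b a' b', fun _ => rfl, fun _ => rfl,
    isLinearMap_copyCoords a b a' b', ?_⟩
  have hza : ∑ j : Fin (i + 1), z j a = ∑ j ∈ Finset.range (i + 1), m j := by
    rw [← Fin.sum_univ_eq_sum_range]
    exact Finset.sum_congr rfl fun j _ => (hz j (by omega)).1
  have hzb : ∑ j : Fin (i + 1), z j b = ∑ j ∈ Finset.range i, m j := by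
    rw [← sum_range_succ_delayed, ← Fin.sum_univ_eq_sum_range]
    exact Finset.sum_congr rfl fun j _ => (hz j (by omega)).2
  rw [hardAtt_scorePhi_zero]
  ext k
  simp only [Pi.smul_apply, Finset.sum_apply, copyCoords, smul_eq_mul]
  split_ifs
  · rw [hza]; push_cast; ring
  · rw [hzb]; push_cast; ring
  · simp
end

section
/- Score-separation inequality (property (eq:min)): let i ∈ ℕ, let ε_k = 1/(k+1) ∈ ℚ for k ∈ ℕ, let c ∈ ℤ and c_0, …, c_i ∈ ℤ, and for 0 ≤ j ≤ i define χ_j = ε_i ε_j (c − c_j) + (ε_i ε_j)²/3. Then: (a) for every j with c_j ≠ c, |χ_j| ≥ (2/3) ε_i²; (b) for every j with c_j = c, |χ_j| = (ε_i ε_j)²/3 ≤ (1/3) ε_i². Consequently, if j_1 satisfies c_{j_1} ≠ c and j_2 satisfies c_{j_2} = c, then |χ_{j_2}| < |χ_{j_1}|. -/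
/-- `ε_k = 1/(k+1)`. -/
def eps (k : ℕ) : ℚ := 1 / ((k : ℚ) + 1)

/-- `χ_j = ε_i ε_j (c − c_j) + (ε_i ε_j)²/3`. -/
def chi (i : ℕ) (c : ℤ) (cs : ℕ → ℤ) (j : ℕ) : ℚ :=
  eps i * eps j * ((c : ℚ) - (cs j : ℚ)) + (eps i * eps j) ^ 2 / 3

theorem eps_pos (k : ℕ) : 0 < eps k := by
  unfold eps
  positivity

theorem eps_le_one (k : ℕ) : eps k ≤ 1 := by
  unfold eps
  rw [div_le_one (by positivity)]
  linarith [Nat.cast_nonneg (α := ℚ) k]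

theorem eps_antitone : Antitone eps := fun _ _ h => by
  unfold eps
  gcongr

theorem two_thirds_mul_le_abs {p : ℚ} (hp : 0 ≤ p) (hp1 : p ≤ 1) {d : ℤ} (hd : d ≠ 0) :
    2 / 3 * p ≤ |p * d + p ^ 2 / 3| := by
  have hsq : p ^ 2 ≤ p := by nlinarith
  rcases lt_or_gt_of_ne hd with h | h
  · have hd' : (d : ℚ) ≤ -1 := by exact_mod_cast (by omega : d ≤ -1)
    exact le_abs.2 (Or.inr (by nlinarith))
  · have hd' : (1 : ℚ) ≤ d := by exact_mod_cast h
    exact le_abs.2 (Or.inl (by nlinarith))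

theorem two_thirds_mul_eps_sq_le_abs_chi {i j : ℕ} {c : ℤ} {cs : ℕ → ℤ} (hj : j ≤ i)
    (hc : cs j ≠ c) : 2 / 3 * eps i ^ 2 ≤ |chi i c cs j| := by
  have hi := eps_pos i
  have hle : eps i ^ 2 ≤ eps i * eps j := by nlinarith [eps_antitone hj]
  have h := two_thirds_mul_le_abs (mul_pos hi (eps_pos j)).le
    (mul_le_one₀ (eps_le_one i) (eps_pos j).le (eps_le_one j)) (sub_ne_zero.2 hc.symm)
  push_cast at h
  unfold chi
  linarith

theorem abs_chi_of_eq {i j : ℕ} {c : ℤ} {cs : ℕ → ℤ} (hc : cs j = c) :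
    |chi i c cs j| = (eps i * eps j) ^ 2 / 3 := by
  rw [chi, hc, sub_self, mul_zero, zero_add, abs_of_nonneg (by positivity)]

theorem eps_mul_eps_sq_div_three_le (i j : ℕ) :
    (eps i * eps j) ^ 2 / 3 ≤ 1 / 3 * eps i ^ 2 := by
  have h := pow_le_pow_left₀ (mul_pos (eps_pos i) (eps_pos j)).le
    (mul_le_of_le_one_right (eps_pos i).le (eps_le_one j)) 2
  linarith

/-- Score-separation inequality (property (eq:min)): for `0 ≤ j ≤ i`,
(a) if `c_j ≠ c` then `|χ_j| ≥ (2/3) ε_i²`;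
(b) if `c_j = c` then `|χ_j| = (ε_i ε_j)²/3 ≤ (1/3) ε_i²`;
consequently, if `c_{j₁} ≠ c` and `c_{j₂} = c` then `|χ_{j₂}| < |χ_{j₁}|`. -/
theorem score_separation (i : ℕ) (c : ℤ) (cs : ℕ → ℤ) :
    (∀ j, j ≤ i → cs j ≠ c → (2 / 3 : ℚ) * (eps i) ^ 2 ≤ |chi i c cs j|) ∧
    (∀ j, j ≤ i → cs j = c →
      |chi i c cs j| = (eps i * eps j) ^ 2 / 3 ∧
      (eps i * eps j) ^ 2 / 3 ≤ (1 / 3 : ℚ) * (eps i) ^ 2) ∧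
    (∀ j₁ j₂, j₁ ≤ i → j₂ ≤ i → cs j₁ ≠ c → cs j₂ = c →
      |chi i c cs j₂| < |chi i c cs j₁|) := by
  refine ⟨fun j hj hc => two_thirds_mul_eps_sq_le_abs_chi hj hc,
    fun j _ hc => ⟨abs_chi_of_eq hc, eps_mul_eps_sq_div_three_le i j⟩,
    fun j₁ j₂ hj₁ _ hc₁ hc₂ => ?_⟩
  rw [abs_chi_of_eq hc₂]
  linarith [two_thirds_mul_eps_sq_le_abs_chi hj₁ hc₁, eps_mul_eps_sq_div_three_le i j₂,
    pow_pos (eps_pos i) 2]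
end

section
/- Conditional gadget by a two-layer feed-forward network (Lemma B.6): for all m, n ∈ ℕ there exist affine transformations f_1 : ℚ^{m+2n+1} → ℚ^{m+2n} and f_2 : ℚ^{m+2n} → ℚ^{m+n} such that the two-layer feed-forward network f = f_2 ∘ σ ∘ f_1 (σ applied componentwise) satisfies, for all binary vectors x ∈ {0,1}^m, y, z ∈ {0,1}^n and every b ∈ {0,1}: f([x, y, z, b]) = [x, y] if b = 0, and f([x, y, z, b]) = [x, z] if b = 1. -/
/-- The piecewise-linear sigmoidal activation σ. -/
def sig (x : ℚ) : ℚ := if x < 0 then 0 else if x ≤ 1 then x else 1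

/-- σ applied componentwise. -/
def sigv {d : ℕ} (v : Vec d) : Vec d := fun i => sig (v i)

/-- `f` is an affine transformation over ℚ. -/
def IsAffine {a b : ℕ} (f : Vec a → Vec b) : Prop :=
  ∃ (g : Vec a → Vec b) (c : Vec b), IsLinearMap ℚ g ∧ ∀ v, f v = g v + c

theorem sig_zero : sig 0 = 0 := by norm_num [sig]

theorem sig_one : sig 1 = 1 := by norm_num [sig]

theorem sig_neg_one : sig (-1) = 0 := by norm_num [sig]

/-- The linear part `[x, y, z, b] ↦ [x, y - b, z + b]` of the first layer. -/
def gateLinear (m n : ℕ) (v : Vec (m + n + n + 1)) : Vec (m + n + n) :=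
  Fin.append
    (Fin.append (fun i : Fin m => v (Fin.castAdd 1 (Fin.castAdd n (Fin.castAdd n i))))
      (fun i : Fin n => v (Fin.castAdd 1 (Fin.castAdd n (Fin.natAdd m i))) -
        v (Fin.natAdd (m + n + n) (0 : Fin 1))))
    (fun i : Fin n => v (Fin.castAdd 1 (Fin.natAdd (m + n) i)) +
      v (Fin.natAdd (m + n + n) (0 : Fin 1)))

/-- The bias `[0, 0, -1]` of the first layer. -/
def gateBias (m n : ℕ) : Vec (m + n + n) :=
  Fin.append (0 : Vec (m + n)) (fun _ : Fin n => (-1 : ℚ))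

/-- The second layer `[x, y, z] ↦ [x, y + z]`. -/
def mergeLinear (m n : ℕ) (v : Vec (m + n + n)) : Vec (m + n) :=
  Fin.append (fun i : Fin m => v (Fin.castAdd n (Fin.castAdd n i)))
    (fun i : Fin n => v (Fin.castAdd n (Fin.natAdd m i)) + v (Fin.natAdd (m + n) i))

theorem isLinearMap_gateLinear (m n : ℕ) : IsLinearMap ℚ (gateLinear m n) := by
  constructor
  · intro v w
    ext i
    refine Fin.addCases (fun i => Fin.addCases (fun i => ?_) (fun i => ?_) i) (fun i => ?_) i <;>
      simp only [gateLinear, Pi.add_apply, Fin.append_left, Fin.append_right] <;> ring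
  · intro c v
    ext i
    refine Fin.addCases (fun i => Fin.addCases (fun i => ?_) (fun i => ?_) i) (fun i => ?_) i <;>
      simp only [gateLinear, Pi.smul_apply, smul_eq_mul, Fin.append_left, Fin.append_right] <;> ring

theorem isLinearMap_mergeLinear (m n : ℕ) : IsLinearMap ℚ (mergeLinear m n) := by
  constructor
  · intro v w
    ext i
    refine Fin.addCases (fun i => ?_) (fun i => ?_) i <;>
      simp only [mergeLinear, Pi.add_apply, Fin.append_left, Fin.append_right] <;> ring
  · intro c v
    ext i
    refine Fin.addCases (fun i => ?_) (fun i => ?_) i <;>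
      simp only [mergeLinear, Pi.smul_apply, smul_eq_mul, Fin.append_left, Fin.append_right] <;>
      ring

/-- The two-layer network evaluated on `[x, y, z, b]`. -/
theorem mergeLinear_sigv_gate {m n : ℕ} (x : Vec m) (y z : Vec n) (b : ℚ) :
    mergeLinear m n (sigv (gateLinear m n
      (Fin.append (Fin.append (Fin.append x y) z) ![b]) + gateBias m n)) =
      Fin.append (fun i => sig (x i)) (fun i => sig (y i - b) + sig (z i + b - 1)) := by
  ext i
  refine Fin.addCases (fun i => ?_) (fun i => ?_) i <;>
    simp only [mergeLinear, sigv, gateLinear, gateBias, Pi.add_apply, Pi.zero_apply,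
      Fin.append_left, Fin.append_right, Matrix.cons_val_zero, add_zero, sub_eq_add_neg]

/-- Conditional gadget by a two-layer feed-forward network (Lemma B.6):
there exist affine `f₁ : ℚ^{m+2n+1} → ℚ^{m+2n}` and `f₂ : ℚ^{m+2n} → ℚ^{m+n}`
such that the two-layer network `f = f₂ ∘ σ ∘ f₁` satisfies, for all binary
vectors `x ∈ {0,1}^m`, `y, z ∈ {0,1}^n` and every `b ∈ {0,1}`:
`f([x,y,z,b]) = [x,y]` if `b = 0`, and `f([x,y,z,b]) = [x,z]` if `b = 1`. -/
theorem if_gadget (m n : ℕ) :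
    ∃ (f₁ : Vec (m + n + n + 1) → Vec (m + n + n)) (f₂ : Vec (m + n + n) → Vec (m + n)),
      IsAffine f₁ ∧ IsAffine f₂ ∧
      ∀ (x : Vec m) (y z : Vec n) (b : ℚ),
        (∀ i, x i = 0 ∨ x i = 1) → (∀ i, y i = 0 ∨ y i = 1) →
        (∀ i, z i = 0 ∨ z i = 1) → (b = 0 ∨ b = 1) →
        (b = 0 →
          f₂ (sigv (f₁ (Fin.append (Fin.append (Fin.append x y) z) ![b]))) =
            Fin.append x y) ∧
        (b = 1 →
          f₂ (sigv (f₁ (Fin.append (Fin.append (Fin.append x y) z) ![b]))) =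
            Fin.append x z) := by
  refine ⟨fun v => gateLinear m n v + gateBias m n, mergeLinear m n,
    ⟨_, _, isLinearMap_gateLinear m n, fun _ => rfl⟩,
    ⟨_, 0, isLinearMap_mergeLinear m n, fun v => (add_zero _).symm⟩, ?_⟩
  intro x y z b hx hy hz _
  have hsx : (fun i => sig (x i)) = x := by
    ext i
    rcases hx i with h | h <;> simp [h, sig_zero, sig_one]
  constructor
  · rintro rfl
    rw [mergeLinear_sigv_gate, hsx]
    congr 1
    ext i
    rcases hy i with h | h <;> rcases hz i with h' | h' <;>
      simp [h, h', sig_zero, sig_one, sig_neg_one]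
  · rintro rfl
    rw [mergeLinear_sigv_gate, hsx]
    congr 1
    ext i
    rcases hy i with h | h <;> rcases hz i with h' | h' <;>
      simp [h, h', sig_zero, sig_one, sig_neg_one]
end

section
/- One-hot pairing by an affine map followed by σ: let Q and Σ be finite sets with enumerations π_2 : Q → {1,…,|Q|} and π_1 : Σ → {1,…,|Σ|}, let ⟦q⟧ ∈ ℚ^{|Q|} and ⟦s⟧ ∈ ℚ^{|Σ|} be the corresponding one-hot vectors, and let ⟦(q,s)⟧ ∈ ℚ^{|Q||Σ|} be the one-hot vector with a 1 at position (π_1(s) − 1)|Q| + π_2(q). Then there exists an affine transformation g_1 : ℚ^{|Q|+|Σ|} → ℚ^{|Q||Σ|} such that σ(g_1([⟦q⟧, ⟦s⟧])) = ⟦(q,s)⟧ for every q ∈ Q and s ∈ Σ, where σ is applied componentwise. Consequently, for any function δ : Q × Σ → Q × Σ × {−1,1} there is a two-layer feed-forward network with activation σ that maps [⟦q⟧, ⟦s⟧] to [⟦q'⟧, ⟦v⟧, m] where (q', v, m) = δ(q, s) (Lemma B.2, core construction). -/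
/-- The one-hot vector of `a` w.r.t. the enumeration `e`. -/
def oneHot {α : Type*} {n : ℕ} (e : α ≃ Fin n) (a : α) : Vec n :=
  fun i => if i = e a then 1 else 0

/-- The one-hot vector of the pair `(q,s)` in ℚ^{|Σ|·|Q|}, with a 1 at
(0-based) position `π₁(s)·|Q| + π₂(q)`. -/
def oneHotPair {Q S : Type*} {nQ nS : ℕ} (e₂ : Q ≃ Fin nQ) (e₁ : S ≃ Fin nS)
    (q : Q) (s : S) : Vec (nS * nQ) :=
  fun i =>
    if (i : ℕ) = (e₁ s : ℕ) * nQ + (e₂ q : ℕ) then 1 else 0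

/-- The pair encoding is the one-hot vector at the row-major index of `(e₁ s, e₂ q)`. -/
theorem oneHotPair_eq_single {Q S : Type*} {nQ nS : ℕ} (e₂ : Q ≃ Fin nQ) (e₁ : S ≃ Fin nS)
    (q : Q) (s : S) :
    oneHotPair e₂ e₁ q s = Pi.single (finProdFinEquiv (e₁ s, e₂ q)) (1 : ℚ) := by
  funext i
  simp only [oneHotPair, Pi.single_apply, Fin.ext_iff, finProdFinEquiv_apply_val]
  rw [Nat.mul_comm nQ, Nat.add_comm]

/-- An affine map can be prescribed arbitrarily on the standard basis. -/
theorem exists_isAffine_apply_single {a b : ℕ} (t : Fin a → Vec b) :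
    ∃ F : Vec a → Vec b, IsAffine F ∧ ∀ i, F (Pi.single i 1) = t i :=
  ⟨Fintype.linearCombination ℚ t,
    ⟨_, 0, (Fintype.linearCombination ℚ t).isLinear, fun _ => (add_zero _).symm⟩,
    fun i => by simp⟩

/-- The conjunction of the indicators `x = 1` and `y = 1` is `σ(x + y - 1)`. -/
theorem sig_indicator_add_indicator (p r : Prop) [Decidable p] [Decidable r] :
    sig ((if p then 1 else 0) + (if r then 1 else 0) + -1) = if r ∧ p then 1 else 0 := by
  by_cases hp : p <;> by_cases hr : r <;> norm_num [sig, hp, hr]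

/-- An affine map followed by σ turns a pair of one-hot vectors into the one-hot vector of the
pair. -/
theorem exists_isAffine_sigv_eq_oneHotPair {Q S : Type*} {nQ nS : ℕ}
    (e₂ : Q ≃ Fin nQ) (e₁ : S ≃ Fin nS) :
    ∃ g : Vec (nQ + nS) → Vec (nS * nQ), IsAffine g ∧
      ∀ q s, sigv (g (Fin.append (oneHot e₂ q) (oneHot e₁ s))) = oneHotPair e₂ e₁ q s := by
  refine ⟨fun v i => v (Fin.castAdd nS i.modNat) + v (Fin.natAdd nQ i.divNat) + -1,
    ⟨fun v i => v (Fin.castAdd nS i.modNat) + v (Fin.natAdd nQ i.divNat), fun _ => -1,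
      ⟨fun x y => ?_, fun c x => ?_⟩, fun v => rfl⟩, fun q s => ?_⟩
  · funext i
    simp only [Pi.add_apply]
    ring
  · funext i
    simp only [Pi.smul_apply, smul_eq_mul]
    ring
  · funext i
    rw [oneHotPair_eq_single, Pi.single_apply]
    simp only [sigv, Fin.append_left, Fin.append_right, oneHot, sig_indicator_add_indicator]
    refine if_congr ?_ rfl rfl
    rw [← finProdFinEquiv.symm_apply_eq, finProdFinEquiv_symm_apply, Prod.mk.injEq]

/-- One-hot pairing by an affine map followed by σ (Lemma B.2, core construction):
for finite `Q`, `Σ` with enumerations `π₂ : Q ≃ Fin |Q|`, `π₁ : Σ ≃ Fin |Σ|`, there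
is an affine `g₁ : ℚ^{|Q|+|Σ|} → ℚ^{|Q||Σ|}` with `σ(g₁([⟦q⟧,⟦s⟧])) = ⟦(q,s)⟧` for
all `q, s`; consequently, for any `δ : Q × Σ → Q × Σ × {−1,1}` there is a two-layer
feed-forward network with activation σ mapping `[⟦q⟧,⟦s⟧]` to `[⟦q'⟧,⟦v⟧,m]`,
where `(q',v,m) = δ(q,s)`. -/
theorem one_hot_pairing (Q S : Type*) [Fintype Q] [Fintype S]
    (e₂ : Q ≃ Fin (Fintype.card Q)) (e₁ : S ≃ Fin (Fintype.card S)) :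
    (∃ g₁ : Vec (Fintype.card Q + Fintype.card S) →
        Vec (Fintype.card S * Fintype.card Q),
      IsAffine g₁ ∧
      ∀ (q : Q) (s : S),
        sigv (g₁ (Fin.append (oneHot e₂ q) (oneHot e₁ s))) = oneHotPair e₂ e₁ q s) ∧
    (∀ δ : Q × S → Q × S × ℚ,
      (∀ p, (δ p).2.2 = -1 ∨ (δ p).2.2 = 1) →
      ∃ (F₁ : Vec (Fintype.card Q + Fintype.card S) →
            Vec (Fintype.card S * Fintype.card Q))
        (F₂ : Vec (Fintype.card S * Fintype.card Q) →
            Vec (Fintype.card Q + Fintype.card S + 1)),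
        IsAffine F₁ ∧ IsAffine F₂ ∧
        ∀ (q : Q) (s : S),
          F₂ (sigv (F₁ (Fin.append (oneHot e₂ q) (oneHot e₁ s)))) =
            Fin.append (Fin.append (oneHot e₂ (δ (q, s)).1) (oneHot e₁ (δ (q, s)).2.1))
              ![(δ (q, s)).2.2]) := by
  obtain ⟨g, hg, hgv⟩ := exists_isAffine_sigv_eq_oneHotPair e₂ e₁
  refine ⟨⟨g, hg, hgv⟩, fun δ _ => ?_⟩
  obtain ⟨F, hF, hFv⟩ := exists_isAffine_apply_single
    fun i : Fin (Fintype.card S * Fintype.card Q) =>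
      let d := δ (e₂.symm i.modNat, e₁.symm i.divNat)
      (Fin.append (Fin.append (oneHot e₂ d.1) (oneHot e₁ d.2.1)) ![d.2.2] :
        Vec (Fintype.card Q + Fintype.card S + 1))
  refine ⟨g, F, hg, hF, fun q s => ?_⟩
  have h := finProdFinEquiv.symm_apply_apply (e₁ s, e₂ q)
  rw [finProdFinEquiv_symm_apply, Prod.mk.injEq] at h
  rw [hgv, oneHotPair_eq_single, hFv]
  simp only [h.1, h.2, Equiv.symm_apply_apply]
end
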